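/- Let A_1, A_2 be full-dimensional finite configurations in ℤ², A = Cay(A_1,A_2) their Cayley configuration, and v a vertex of A_i (i = 1 or 2), regarded also as a vertex of A. Then u(v, A) = u(v, A_i) + mmult(v). -/

import Mathlib

open scoped Pointwise
open MeasureTheory

noncomputable section

abbrev Pt : Type := ℤ × ℤ
abbrev Pt3 : Type := ℤ × ℤ × ℤ
abbrev Pt4 : Type := (ℤ × ℤ) × (ℤ × ℤ)

def toR2 (p : Pt) : ℝ × ℝ := ((p.1 : ℝ), (p.2 : ℝ))
def toR3 (p : Pt3) : ℝ × ℝ × ℝ := ((p.1 : ℝ), (p.2.1 : ℝ), (p.2.2 : ℝ))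

/-- Normalized lattice area (a primitive lattice triangle has area 1). -/
def narea (A : Finset Pt) : ℝ :=
  2 * (volume (convexHull ℝ (toR2 '' (A : Set Pt)))).toReal

/-- Normalized 3-dimensional lattice volume (a primitive lattice tetrahedron has
volume 1). -/
def nvol3 (S : Finset Pt3) : ℝ :=
  6 * (volume (convexHull ℝ (toR3 '' (S : Set Pt3)))).toReal

/-- A planar configuration is full-dimensional if its points are not collinear. -/
def FullDim (A : Finset Pt) : Prop := ¬ Collinear ℝ (toR2 '' (A : Set Pt))

/-- Mixed volume (mixed area) of the convex hulls of two configurations. -/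
def mvol (A B : Finset Pt) : ℝ := (narea (A + B) - narea A - narea B) / 2

def IsVertex (A : Finset Pt) (v : Pt) : Prop :=
  v ∈ A ∧ toR2 v ∉ convexHull ℝ (toR2 '' ((A.erase v) : Set Pt))

/-- Mixed multiplicity of a point of the first configuration. -/
def mmult (A B : Finset Pt) (v : Pt) : ℝ := mvol A B - mvol (A.erase v) B

/-- the Cayley configuration `Cay(A₁,A₂) ⊂ ℤ⁴`. -/
def cayley4 (A₁ A₂ : Finset Pt) : Finset Pt4 :=
  A₁.image (fun a => ((((1:ℤ),(0:ℤ)) : Pt), a)) ∪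
    A₂.image (fun b => ((((0:ℤ),(1:ℤ)) : Pt), b))

/-- The standard scalar product on `ℝ × ℝ`. -/
def dot (a x : ℝ × ℝ) : ℝ := a.1 * x.1 + a.2 * x.2

/-- The partition function `x ↦ ∑ exp ⟨a, x⟩` of a finite planar configuration. -/
def expSum (A : Finset (ℝ × ℝ)) (x : ℝ × ℝ) : ℝ := ∑ a ∈ A, Real.exp (dot a x)

/-- The gradient of `log (expSum A)`: the mean of `A` for the weights `exp ⟨a, x⟩`. -/
def expMean (A : Finset (ℝ × ℝ)) (x : ℝ × ℝ) : ℝ × ℝ :=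
  (expSum A x)⁻¹ • ∑ a ∈ A, Real.exp (dot a x) • a

/-- No nonzero linear functional is constant on `A`. -/
def Spans (A : Finset (ℝ × ℝ)) : Prop :=
  ∀ h : ℝ × ℝ, h ≠ 0 → ∃ a ∈ A, ∃ b ∈ A, dot a h ≠ dot b h

lemma dot_add_left (a b x : ℝ × ℝ) : dot (a + b) x = dot a x + dot b x := by
  simp [dot]; ring

lemma dot_sub_left (a b x : ℝ × ℝ) : dot (a - b) x = dot a x - dot b x := by
  simp [dot]; ring

lemma dot_smul_left (c : ℝ) (a x : ℝ × ℝ) : dot (c • a) x = c * dot a x := by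
  simp [dot]; ring

lemma dot_add_right (a x y : ℝ × ℝ) : dot a (x + y) = dot a x + dot a y := by
  simp [dot]; ring

lemma dot_sub_right (a x y : ℝ × ℝ) : dot a (x - y) = dot a x - dot a y := by
  simp [dot]; ring

lemma dot_smul_right (c : ℝ) (a x : ℝ × ℝ) : dot a (c • x) = c * dot a x := by
  simp [dot]; ring

lemma dot_sum_left (A : Finset (ℝ × ℝ)) (f : ℝ × ℝ → ℝ × ℝ) (x : ℝ × ℝ) :
    dot (∑ a ∈ A, f a) x = ∑ a ∈ A, dot (f a) x := by
  simp [dot, Prod.fst_sum, Prod.snd_sum, Finset.sum_mul, Finset.sum_add_distrib]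

lemma sq_norm_le_dot_self (x : ℝ × ℝ) : ‖x‖ ^ 2 ≤ dot x x := by
  rcases max_choice ‖x.1‖ ‖x.2‖ with h | h <;>
  · rw [Prod.norm_def, h, Real.norm_eq_abs, sq_abs, dot]
    nlinarith [sq_nonneg x.1, sq_nonneg x.2]

lemma eq_zero_of_dot_self_eq_zero {x : ℝ × ℝ} (h : dot x x = 0) : x = 0 := by
  have := sq_norm_le_dot_self x
  rw [h] at this
  exact norm_eq_zero.1 (by nlinarith [norm_nonneg x])

lemma convex_dot_le (x : ℝ × ℝ) (c : ℝ) : Convex ℝ {p : ℝ × ℝ | dot p x ≤ c} := by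
  refine convex_halfSpace_le ⟨fun a b => dot_add_left a b x, fun r a => dot_smul_left r a x⟩ c

lemma expSum_pos {A : Finset (ℝ × ℝ)} (hA : A.Nonempty) (x : ℝ × ℝ) : 0 < expSum A x :=
  Finset.sum_pos (fun _ _ => Real.exp_pos _) hA

lemma continuous_expSum (A : Finset (ℝ × ℝ)) : Continuous (expSum A) := by
  unfold expSum dot; fun_prop

lemma differentiable_expMean {A : Finset (ℝ × ℝ)} (hA : A.Nonempty) :
    Differentiable ℝ (expMean A) := by
  have h1 : Differentiable ℝ (expSum A) := by unfold expSum dot; fun_prop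
  have h2 : Differentiable ℝ fun x : ℝ × ℝ => ∑ a ∈ A, Real.exp (dot a x) • a := by
    unfold dot; fun_prop
  exact (h1.inv fun x => (expSum_pos hA x).ne').smul h2

lemma expMean_mem_convexHull {A : Finset (ℝ × ℝ)} (hA : A.Nonempty) (x : ℝ × ℝ) :
    expMean A x ∈ convexHull ℝ (A : Set (ℝ × ℝ)) := by
  have h := A.centerMass_mem_convexHull (w := fun a => Real.exp (dot a x)) (z := id)
    (s := (A : Set (ℝ × ℝ))) (fun _ _ => (Real.exp_pos _).le) (expSum_pos hA x)
    (fun a ha => ha)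
  simpa [Finset.centerMass, expMean, expSum] using h

lemma dot_expMean (A : Finset (ℝ × ℝ)) (x h : ℝ × ℝ) :
    dot (expMean A x) h = (∑ a ∈ A, Real.exp (dot a x) * dot a h) / expSum A x := by
  simp only [expMean, dot_smul_left, dot_sum_left]
  rw [div_eq_inv_mul]

lemma dot_le_log_expSum {A : Finset (ℝ × ℝ)} {p : ℝ × ℝ}
    (hp : p ∈ convexHull ℝ (A : Set (ℝ × ℝ))) (x : ℝ × ℝ) :
    dot p x ≤ Real.log (expSum A x) := by
  refine convexHull_min (t := {p | dot p x ≤ Real.log (expSum A x)}) ?_ (convex_dot_le x _) hp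
  intro a ha
  rw [Set.mem_ofPred_eq, Real.le_log_iff_exp_le (expSum_pos ⟨a, ha⟩ x)]
  exact Finset.single_le_sum (f := fun a => Real.exp (dot a x))
    (fun _ _ => (Real.exp_pos _).le) ha

lemma exp_sub_exp_mul_sub_pos {u v : ℝ} (h : u ≠ v) :
    0 < (Real.exp u - Real.exp v) * (u - v) := by
  rcases lt_or_gt_of_ne h with h | h
  · exact mul_pos_of_neg_of_neg (sub_neg.2 (Real.exp_lt_exp.2 h)) (sub_neg.2 h)
  · exact mul_pos (sub_pos.2 (Real.exp_lt_exp.2 h)) (sub_pos.2 h)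

lemma exp_sub_exp_mul_sub_nonneg (u v : ℝ) : 0 ≤ (Real.exp u - Real.exp v) * (u - v) := by
  rcases eq_or_ne u v with rfl | h
  · simp
  · exact (exp_sub_exp_mul_sub_pos h).le

lemma two_mul_expSum_mul_dot_expMean_sub {A : Finset (ℝ × ℝ)} (hA : A.Nonempty)
    (x y : ℝ × ℝ) :
    2 * (expSum A x * expSum A y * dot (expMean A x - expMean A y) (x - y)) =
      ∑ a ∈ A, ∑ b ∈ A, (Real.exp (dot a x + dot b y) - Real.exp (dot b x + dot a y)) *
        ((dot a x + dot b y) - (dot b x + dot a y)) := by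
  set h := x - y with hh
  have key : expSum A x * expSum A y * dot (expMean A x - expMean A y) h =
      ∑ a ∈ A, ∑ b ∈ A, Real.exp (dot a x) * Real.exp (dot b y) * (dot a h - dot b h) := by
    have hx := (expSum_pos hA x).ne'
    have hy := (expSum_pos hA y).ne'
    rw [dot_sub_left, dot_expMean, dot_expMean]
    have : expSum A x * expSum A y * ((∑ a ∈ A, Real.exp (dot a x) * dot a h) / expSum A x -
        (∑ a ∈ A, Real.exp (dot a y) * dot a h) / expSum A y) =
        (∑ a ∈ A, Real.exp (dot a x) * dot a h) * expSum A y -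
          expSum A x * ∑ a ∈ A, Real.exp (dot a y) * dot a h := by
      field_simp
    rw [this]
    simp only [expSum, Finset.sum_mul_sum, ← Finset.sum_sub_distrib]
    refine Finset.sum_congr rfl fun a _ => Finset.sum_congr rfl fun b _ => by ring
  have key' := key
  rw [Finset.sum_comm] at key'
  rw [two_mul]
  nth_rw 1 [key]
  rw [key']
  simp only [← Finset.sum_add_distrib]
  refine Finset.sum_congr rfl fun a _ => Finset.sum_congr rfl fun b _ => ?_
  simp only [hh, dot_sub_right, Real.exp_add]
  ring

lemma dot_expMean_sub_nonneg {A : Finset (ℝ × ℝ)} (hA : A.Nonempty) (x y : ℝ × ℝ) :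
    0 ≤ dot (expMean A x - expMean A y) (x - y) := by
  have h := two_mul_expSum_mul_dot_expMean_sub hA x y
  have h0 : 0 ≤ expSum A x * expSum A y * dot (expMean A x - expMean A y) (x - y) := by
    have := Finset.sum_nonneg fun a (_ : a ∈ A) => Finset.sum_nonneg fun b (_ : b ∈ A) =>
      exp_sub_exp_mul_sub_nonneg (dot a x + dot b y) (dot b x + dot a y)
    linarith
  exact nonneg_of_mul_nonneg_right h0 (mul_pos (expSum_pos hA x) (expSum_pos hA y))

lemma dot_expMean_sub_pos {A : Finset (ℝ × ℝ)} (hA : A.Nonempty) (hs : Spans A)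
    {x y : ℝ × ℝ} (hxy : x ≠ y) : 0 < dot (expMean A x - expMean A y) (x - y) := by
  obtain ⟨a, ha, b, hb, hab⟩ := hs (x - y) (sub_ne_zero.2 hxy)
  have h := two_mul_expSum_mul_dot_expMean_sub hA x y
  have h0 : 0 < expSum A x * expSum A y * dot (expMean A x - expMean A y) (x - y) := by
    have : 0 < ∑ a ∈ A, ∑ b ∈ A,
        (Real.exp (dot a x + dot b y) - Real.exp (dot b x + dot a y)) *
        ((dot a x + dot b y) - (dot b x + dot a y)) := by
      refine Finset.sum_pos' (fun a _ => Finset.sum_nonneg fun b _ =>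
        exp_sub_exp_mul_sub_nonneg _ _) ⟨a, ha, Finset.sum_pos' (fun b _ =>
        exp_sub_exp_mul_sub_nonneg _ _) ⟨b, hb, exp_sub_exp_mul_sub_pos ?_⟩⟩
      intro he
      rw [dot_sub_right, dot_sub_right] at hab
      exact hab (by linarith)
    linarith
  exact pos_of_mul_pos_right h0 (mul_pos (expSum_pos hA x) (expSum_pos hA y)).le

lemma hasDerivAt_log_expSum_line {A : Finset (ℝ × ℝ)} (hA : A.Nonempty) (x h : ℝ × ℝ) :
    HasDerivAt (fun r : ℝ => Real.log (expSum A (x + r • h))) (dot (expMean A x) h) 0 := by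
  have h1 : ∀ a : ℝ × ℝ, HasDerivAt (fun r : ℝ => Real.exp (dot a (x + r • h)))
      (Real.exp (dot a x) * dot a h) 0 := by
    intro a
    have : HasDerivAt (fun r : ℝ => dot a (x + r • h)) (dot a h) 0 := by
      simp only [dot_add_right, dot_smul_right]
      simpa using ((hasDerivAt_id (0 : ℝ)).mul_const (dot a h)).const_add (dot a x)
    simpa using this.exp
  have h2 : HasDerivAt (fun r : ℝ => expSum A (x + r • h))
      (∑ a ∈ A, Real.exp (dot a x) * dot a h) 0 := by
    simpa only [expSum] using HasDerivAt.fun_sum fun a (_ : a ∈ A) => h1 a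
  rw [dot_expMean]
  simpa using h2.log (by simpa using (expSum_pos hA x).ne')

lemma exists_expMean_eq_of_mem_interior {A B : Finset (ℝ × ℝ)} (hA : A.Nonempty)
    (hB : B.Nonempty) {s t : ℝ} (hs : 0 ≤ s) (ht : 0 ≤ t) {y : ℝ × ℝ}
    (hy : y ∈ interior (s • convexHull ℝ (A : Set (ℝ × ℝ)) +
      t • convexHull ℝ (B : Set (ℝ × ℝ)))) :
    ∃ x, s • expMean A x + t • expMean B x = y := by
  set Φ : ℝ × ℝ → ℝ := fun x =>
    s * Real.log (expSum A x) + t * Real.log (expSum B x) - dot y x with hΦ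
  have hcont : Continuous Φ := by
    have h1 := (continuous_expSum A).log fun x => (expSum_pos hA x).ne'
    have h2 := (continuous_expSum B).log fun x => (expSum_pos hB x).ne'
    have h3 : Continuous fun x => dot y x := by unfold dot; fun_prop
    fun_prop
  have hlow : ∀ z ∈ s • convexHull ℝ (A : Set (ℝ × ℝ)) + t • convexHull ℝ (B : Set (ℝ × ℝ)),
      ∀ x, dot (z - y) x ≤ Φ x := by
    rintro _ ⟨_, ⟨p, hp, rfl⟩, _, ⟨q, hq, rfl⟩, rfl⟩ x
    have h1 := mul_le_mul_of_nonneg_left (dot_le_log_expSum hp x) hs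
    have h2 := mul_le_mul_of_nonneg_left (dot_le_log_expSum hq x) ht
    simp only [dot_sub_left, dot_add_left, dot_smul_left, hΦ]
    linarith
  obtain ⟨r, hr, hball⟩ := Metric.mem_nhds_iff.1 (mem_interior_iff_mem_nhds.1 hy)
  have hcoer : ∀ x, r / 2 * ‖x‖ ≤ Φ x := by
    intro x
    rcases eq_or_ne x 0 with rfl | hx
    · have := hlow y (interior_subset hy) 0
      simpa [dot] using this
    have hn : 0 < ‖x‖ := norm_pos_iff.2 hx
    have hz : y + (r / 2 / ‖x‖) • x ∈ Metric.ball y r := by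
      rw [Metric.mem_ball, dist_eq_norm, add_sub_cancel_left, norm_smul, Real.norm_eq_abs,
        abs_of_pos (by positivity), div_mul_cancel₀ _ hn.ne']
      linarith
    have h1 := hlow _ (hball hz) x
    rw [add_sub_cancel_left, dot_smul_left] at h1
    refine le_trans ?_ h1
    calc r / 2 * ‖x‖ = r / 2 / ‖x‖ * ‖x‖ ^ 2 := by field_simp
      _ ≤ _ := by gcongr; exact sq_norm_le_dot_self x
  have htend : Filter.Tendsto Φ (Filter.cocompact (ℝ × ℝ)) Filter.atTop :=
    Filter.tendsto_atTop_mono hcoer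
      ((tendsto_norm_cocompact_atTop (E := ℝ × ℝ)).const_mul_atTop (by positivity))
  obtain ⟨x, hx⟩ := hcont.exists_forall_le htend
  refine ⟨x, ?_⟩
  have hder : ∀ h, dot (s • expMean A x + t • expMean B x - y) h = 0 := by
    intro h
    have h3 : HasDerivAt (fun r : ℝ => dot y (x + r • h)) (dot y h) 0 := by
      simp only [dot_add_right, dot_smul_right]
      simpa using ((hasDerivAt_id (0 : ℝ)).mul_const (dot y h)).const_add (dot y x)
    have hd := (((hasDerivAt_log_expSum_line hA x h).const_mul s).add
      ((hasDerivAt_log_expSum_line hB x h).const_mul t)).sub h3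
    have hmin : IsLocalMin (fun r : ℝ => Φ (x + r • h)) 0 :=
      Filter.Eventually.of_forall fun r => by simpa using hx (x + r • h)
    have := hmin.hasDerivAt_eq_zero hd
    rw [dot_sub_left, dot_add_left, dot_smul_left, dot_smul_left]
    exact this
  exact sub_eq_zero.1 (eq_zero_of_dot_self_eq_zero (hder _))

lemma det_eq_of_prod (T : ℝ × ℝ →L[ℝ] ℝ × ℝ) :
    T.det = (T (1, 0)).1 * (T (0, 1)).2 - (T (0, 1)).1 * (T (1, 0)).2 := by
  rw [ContinuousLinearMap.det, ← LinearMap.det_toMatrix (Module.Basis.finTwoProd ℝ),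
    Matrix.det_fin_two]
  simp [LinearMap.toMatrix_apply]

lemma det_smul_add_smul (S T : ℝ × ℝ →L[ℝ] ℝ × ℝ) (s t : ℝ) :
    (s • S + t • T).det =
      s ^ 2 * S.det + s * t * ((S + T).det - S.det - T.det) + t ^ 2 * T.det := by
  simp only [det_eq_of_prod, add_apply, smul_apply,
    Prod.fst_add, Prod.snd_add, Prod.smul_fst, Prod.smul_snd, smul_eq_mul]
  ring

lemma det_nonneg_of_dot_nonneg {T : ℝ × ℝ →L[ℝ] ℝ × ℝ} (hT : ∀ h, 0 ≤ dot (T h) h) :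
    0 ≤ T.det := by
  rw [det_eq_of_prod]
  have hlin : ∀ x y : ℝ, T (x, y) = x • T (1, 0) + y • T (0, 1) := by
    intro x y
    rw [← map_smul, ← map_smul, ← map_add]
    simp
  set p := T (1, 0)
  set q := T (0, 1)
  have hq : ∀ x y : ℝ, 0 ≤ (x * p.1 + y * q.1) * x + (x * p.2 + y * q.2) * y := by
    intro x y
    simpa [dot, hlin x y] using hT (x, y)
  have hp1 : 0 ≤ p.1 := by simpa using hq 1 0
  have hq2 : 0 ≤ q.2 := by simpa using hq 0 1
  have hdisc : discrim p.1 (q.1 + p.2) q.2 ≤ 0 :=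
    discrim_le_zero fun x => by have := hq x 1; nlinarith
  rw [discrim] at hdisc
  nlinarith [sq_nonneg (q.1 - p.2)]

lemma dot_fderiv_nonneg {f : ℝ × ℝ → ℝ × ℝ} {T : ℝ × ℝ →L[ℝ] ℝ × ℝ} {x : ℝ × ℝ}
    (hf : HasFDerivAt f T x) (hmono : ∀ y, 0 ≤ dot (f y - f x) (y - x)) (h : ℝ × ℝ) :
    0 ≤ dot (T h) h := by
  have hline : HasDerivAt (fun r : ℝ => f (x + r • h)) (T h) 0 := by
    have h1 : HasDerivAt (fun r : ℝ => x + r • h) h 0 := by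
      simpa using ((hasDerivAt_id (0 : ℝ)).smul_const h).const_add x
    have h2 : HasFDerivAt f T (x + (0 : ℝ) • h) := by simpa using hf
    exact h2.comp_hasDerivAt 0 h1
  have ht := hline.tendsto_slope_zero_right
  have hc : Continuous fun z : ℝ × ℝ => dot z h := by unfold dot; fun_prop
  refine ge_of_tendsto ((hc.tendsto _).comp ht) ?_
  filter_upwards [self_mem_nhdsWithin] with r hr
  have hr : 0 < r := hr
  have := hmono (x + r • h)
  rw [add_sub_cancel_left, dot_smul_right] at this
  simp only [Function.comp, zero_add, zero_smul, add_zero, dot_smul_left]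
  exact mul_nonneg (by positivity) (nonneg_of_mul_nonneg_right this hr)

lemma det_fderiv_expMean_nonneg {A B : Finset (ℝ × ℝ)} (hA : A.Nonempty) (hB : B.Nonempty)
    {s t : ℝ} (hs : 0 ≤ s) (ht : 0 ≤ t) (x : ℝ × ℝ) :
    0 ≤ (s • fderiv ℝ (expMean A) x + t • fderiv ℝ (expMean B) x).det := by
  refine det_nonneg_of_dot_nonneg fun h => ?_
  have h1 := dot_fderiv_nonneg (differentiable_expMean hA x).hasFDerivAt
    (fun y => dot_expMean_sub_nonneg hA y x) h
  have h2 := dot_fderiv_nonneg (differentiable_expMean hB x).hasFDerivAt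
    (fun y => dot_expMean_sub_nonneg hB y x) h
  simp only [add_apply, smul_apply, dot_add_left,
    dot_smul_left]
  positivity

lemma injective_smul_expMean_add {A B : Finset (ℝ × ℝ)} (hA : A.Nonempty) (hB : B.Nonempty)
    (hBs : Spans B) {s t : ℝ} (hs : 0 ≤ s) (ht : 0 < t) :
    Function.Injective fun x => s • expMean A x + t • expMean B x := by
  intro x y hxy
  by_contra hne
  have h1 := mul_nonneg hs (dot_expMean_sub_nonneg hA x y)
  have h2 := mul_pos ht (dot_expMean_sub_pos hB hBs hne)
  have h3 : dot ((s • expMean A x + t • expMean B x) - (s • expMean A y + t • expMean B y))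
      (x - y) = 0 := by
    rw [show s • expMean A x + t • expMean B x = s • expMean A y + t • expMean B y from hxy,
      sub_self]
    simp [dot]
  simp only [dot_sub_left, dot_add_left, dot_smul_left] at h1 h2 h3
  linarith

lemma isCompact_smul_convexHull_add (A B : Finset (ℝ × ℝ)) (s t : ℝ) :
    IsCompact (s • convexHull ℝ (A : Set (ℝ × ℝ)) + t • convexHull ℝ (B : Set (ℝ × ℝ))) :=
  (A.finite_toSet.isCompact_convexHull ℝ |>.smul s).add
    (B.finite_toSet.isCompact_convexHull ℝ |>.smul t)

lemma range_smul_expMean_add_ae_eq {A B : Finset (ℝ × ℝ)} (hA : A.Nonempty)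
    (hB : B.Nonempty) {s t : ℝ} (hs : 0 ≤ s) (ht : 0 ≤ t) :
    ((fun x => s • expMean A x + t • expMean B x) '' Set.univ : Set (ℝ × ℝ)) =ᵐ[volume]
      (s • convexHull ℝ (A : Set (ℝ × ℝ)) + t • convexHull ℝ (B : Set (ℝ × ℝ)) :
        Set (ℝ × ℝ)) := by
  set K := s • convexHull ℝ (A : Set (ℝ × ℝ)) + t • convexHull ℝ (B : Set (ℝ × ℝ))
  have hK : Convex ℝ K := ((convex_convexHull ℝ _).smul s).add ((convex_convexHull ℝ _).smul t)
  have hsub : ((fun x => s • expMean A x + t • expMean B x) '' Set.univ) ⊆ K := by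
    rintro _ ⟨x, -, rfl⟩
    exact Set.add_mem_add (Set.smul_mem_smul_set (expMean_mem_convexHull hA x))
      (Set.smul_mem_smul_set (expMean_mem_convexHull hB x))
  refine (LE.le.eventuallyLE hsub).antisymm ?_
  refine (interior_ae_eq_of_null_frontier (hK.addHaar_frontier volume)).symm.le.trans
    (LE.le.eventuallyLE ?_)
  intro y hy
  obtain ⟨x, hx⟩ := exists_expMean_eq_of_mem_interior hA hB hs ht hy
  exact ⟨x, trivial, hx⟩

lemma integrable_det_and_integral_eq {A B : Finset (ℝ × ℝ)} (hA : A.Nonempty)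
    (hB : B.Nonempty) (hBs : Spans B) {s t : ℝ} (hs : 0 ≤ s) (ht : 0 < t) :
    Integrable (fun x => (s • fderiv ℝ (expMean A) x + t • fderiv ℝ (expMean B) x).det) ∧
    ∫ x, (s • fderiv ℝ (expMean A) x + t • fderiv ℝ (expMean B) x).det =
      volume.real (s • convexHull ℝ (A : Set (ℝ × ℝ)) +
        t • convexHull ℝ (B : Set (ℝ × ℝ))) := by
  have hder : ∀ x ∈ (Set.univ : Set (ℝ × ℝ)),
      HasFDerivWithinAt (fun x => s • expMean A x + t • expMean B x)
        (s • fderiv ℝ (expMean A) x + t • fderiv ℝ (expMean B) x) Set.univ x := fun x _ =>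
    (((differentiable_expMean hA x).hasFDerivAt.const_smul s).add
      ((differentiable_expMean hB x).hasFDerivAt.const_smul t)).hasFDerivWithinAt
  have hinj := (injective_smul_expMean_add hA hB hBs hs ht).injOn (s := Set.univ)
  have hae := range_smul_expMean_add_ae_eq hA hB hs ht.le
  have habs := fun x => abs_of_nonneg (det_fderiv_expMean_nonneg hA hB hs ht.le x)
  constructor
  · have h := (integrableOn_image_iff_integrableOn_abs_det_fderiv_smul volume
      MeasurableSet.univ hder hinj (fun _ => (1 : ℝ))).1 (by
        rw [integrableOn_congr_set_ae hae]
        exact integrableOn_const (isCompact_smul_convexHull_add A B s t).measure_lt_top.ne)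
    simpa [habs] using h
  · have h := integral_image_eq_integral_abs_det_fderiv_smul volume
      MeasurableSet.univ hder hinj (fun _ => (1 : ℝ))
    rw [setIntegral_congr_set hae] at h
    simpa [habs] using h.symm

lemma not_spans_iff {A : Finset (ℝ × ℝ)} :
    ¬ Spans A ↔ ∃ h : ℝ × ℝ, h ≠ 0 ∧ ∀ a ∈ A, ∀ b ∈ A, dot a h = dot b h := by
  simp [Spans]

lemma volume_convexHull_eq_zero_of_not_spans {A : Finset (ℝ × ℝ)} (hA : A.Nonempty)
    (hAs : ¬ Spans A) : volume (convexHull ℝ (A : Set (ℝ × ℝ))) = 0 := by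
  obtain ⟨h, hh, hc⟩ := not_spans_iff.1 hAs
  obtain ⟨a, ha⟩ := hA
  let ℓ : ℝ × ℝ →ₗ[ℝ] ℝ :=
    { toFun := fun p => dot p h
      map_add' := fun p q => dot_add_left p q h
      map_smul' := fun c p => dot_smul_left c p h }
  have hne : AffineSubspace.mk' a (LinearMap.ker ℓ) ≠ ⊤ := by
    intro htop
    have hmem : a + h ∈ AffineSubspace.mk' a (LinearMap.ker ℓ) := by
      rw [htop]; trivial
    rw [AffineSubspace.mem_mk', vsub_eq_sub, add_sub_cancel_left, LinearMap.mem_ker] at hmem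
    exact hh (eq_zero_of_dot_self_eq_zero hmem)
  refine measure_mono_null (convexHull_min ?_ (AffineSubspace.convex _))
    (Measure.addHaar_affineSubspace volume _ hne)
  intro b hb
  rw [SetLike.mem_coe, AffineSubspace.mem_mk', vsub_eq_sub, LinearMap.mem_ker]
  change dot (b - a) h = 0
  rw [dot_sub_left, hc b hb a ha, sub_self]

lemma det_fderiv_expMean_eq_zero_of_not_spans {A : Finset (ℝ × ℝ)} (hA : A.Nonempty)
    (hAs : ¬ Spans A) (x : ℝ × ℝ) : (fderiv ℝ (expMean A) x).det = 0 := by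
  obtain ⟨h, hh, hc⟩ := not_spans_iff.1 hAs
  obtain ⟨a, ha⟩ := id hA
  have hconst : ∀ y, dot (expMean A y) h = dot a h := by
    intro y
    rw [dot_expMean, div_eq_iff (expSum_pos hA y).ne', expSum, Finset.mul_sum]
    exact Finset.sum_congr rfl fun b hb => by rw [hc b hb a ha, mul_comm]
  have hdot : ∀ k, dot (fderiv ℝ (expMean A) x k) h = 0 := by
    intro k
    have hd := (differentiable_expMean hA x).hasFDerivAt
    have h1 : HasFDerivAt (fun y => dot (expMean A y) h)
        (h.1 • (ContinuousLinearMap.fst ℝ ℝ ℝ).comp (fderiv ℝ (expMean A) x) +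
          h.2 • (ContinuousLinearMap.snd ℝ ℝ ℝ).comp (fderiv ℝ (expMean A) x)) x := by
      have := (hd.fst.mul_const h.1).add (hd.snd.mul_const h.2)
      exact this
    simp only [hconst] at h1
    have h2 := congrArg (fun T => T k) (h1.unique (hasFDerivAt_const (dot a h) x))
    simp at h2
    simp only [dot]
    linarith
  rw [det_eq_of_prod]
  have e1 := hdot (1, 0)
  have e2 := hdot (0, 1)
  simp only [dot] at e1 e2
  rcases ne_or_eq h.1 0 with h1 | h1
  · refine mul_left_cancel₀ h1 ?_
    linear_combination (fderiv ℝ (expMean A) x (0, 1)).2 * e1 -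
      (fderiv ℝ (expMean A) x (1, 0)).2 * e2
  · have h2 : h.2 ≠ 0 := fun h2 => hh (Prod.ext h1 h2)
    refine mul_left_cancel₀ h2 ?_
    linear_combination (fderiv ℝ (expMean A) x (1, 0)).1 * e2 -
      (fderiv ℝ (expMean A) x (0, 1)).1 * e1

lemma integral_det_fderiv_expMean {A : Finset (ℝ × ℝ)} (hA : A.Nonempty) :
    ∫ x, (fderiv ℝ (expMean A) x).det = volume.real (convexHull ℝ (A : Set (ℝ × ℝ))) := by
  by_cases hs : Spans A
  · have h := (integrable_det_and_integral_eq hA hA hs le_rfl one_pos).2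
    have h0 : (0 : ℝ) • convexHull ℝ (A : Set (ℝ × ℝ)) = 0 :=
      Set.zero_smul_set hA.to_set.convexHull
    rw [h0, zero_add, one_smul] at h
    simpa using h
  · simp [det_fderiv_expMean_eq_zero_of_not_spans hA hs, measureReal_def,
      volume_convexHull_eq_zero_of_not_spans hA hs]

lemma integral_mul_add_mul_sub_sub_add_mul {p m r : ℝ × ℝ → ℝ} (hp : Integrable p)
    (hm : Integrable m) (hr : Integrable r) (a b c : ℝ) :
    ∫ x, (a * p x + b * (m x - p x - r x) + c * r x) =
      a * (∫ x, p x) + b * ((∫ x, m x) - (∫ x, p x) - ∫ x, r x) + c * ∫ x, r x := by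
  have hmp : Integrable fun x => m x - p x := hm.sub hp
  have hmpr : Integrable fun x => m x - p x - r x := hmp.sub hr
  have hsum : Integrable fun x => a * p x + b * (m x - p x - r x) :=
    (hp.const_mul a).add (hmpr.const_mul b)
  rw [integral_add hsum (hr.const_mul c), integral_add (hp.const_mul a) (hmpr.const_mul b),
    integral_const_mul, integral_const_mul, integral_const_mul, integral_sub hmp hr,
    integral_sub hm hp]

/-- Minkowski's theorem in the plane: the area of `sP + tQ` is a quadratic form in `(s, t)`. -/
theorem volume_smul_convexHull_add_smul_convexHull {A B : Finset (ℝ × ℝ)} (hA : A.Nonempty)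
    (hB : B.Nonempty) (hBs : Spans B) {s t : ℝ} (hs : 0 ≤ s) (ht : 0 < t) :
    volume.real (s • convexHull ℝ (A : Set (ℝ × ℝ)) + t • convexHull ℝ (B : Set (ℝ × ℝ))) =
      s ^ 2 * volume.real (convexHull ℝ (A : Set (ℝ × ℝ))) +
      s * t * (volume.real (convexHull ℝ (A : Set (ℝ × ℝ)) + convexHull ℝ (B : Set (ℝ × ℝ))) -
        volume.real (convexHull ℝ (A : Set (ℝ × ℝ))) -
        volume.real (convexHull ℝ (B : Set (ℝ × ℝ)))) +
      t ^ 2 * volume.real (convexHull ℝ (B : Set (ℝ × ℝ))) := by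
  set S := fderiv ℝ (expMean A)
  set T := fderiv ℝ (expMean B)
  have hi : ∀ s : ℝ, 0 ≤ s → Integrable fun x => (s • S x + (1 : ℝ) • T x).det := fun s hs =>
    (integrable_det_and_integral_eq hA hB hBs hs one_pos).1
  have hT : Integrable fun x => (T x).det := by simpa using hi 0 le_rfl
  have hST : Integrable fun x => (S x + T x).det := by simpa using hi 1 zero_le_one
  have hS : Integrable fun x => (S x).det := by
    refine ((((hi 2 zero_le_two).sub (hST.const_mul 2)).add hT).const_mul (1 / 2)).congr ?_
    filter_upwards with x
    simp only [Pi.add_apply, Pi.sub_apply, det_smul_add_smul]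
    ring
  have h11 := (integrable_det_and_integral_eq hA hB hBs zero_le_one one_pos).2
  simp only [one_smul] at h11
  rw [← (integrable_det_and_integral_eq hA hB hBs hs ht).2, ← h11,
    ← integral_det_fderiv_expMean hA, ← integral_det_fderiv_expMean hB]
  simp only [det_smul_add_smul]
  exact integral_mul_add_mul_sub_sub_add_mul hS hST hT _ _ _

/-- The Cayley configuration of two planar sets, as a subset of `ℝ × ℝ²`. -/
def cayleySet (P Q : Set (ℝ × ℝ)) : Set (ℝ × ℝ × ℝ) := {0} ×ˢ P ∪ {1} ×ˢ Q

lemma mk_mem_convexHull_cayleySet {P Q : Set (ℝ × ℝ)} (hP : P.Nonempty) (hQ : Q.Nonempty)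
    (t : ℝ) (p : ℝ × ℝ) :
    (t, p) ∈ convexHull ℝ (cayleySet P Q) ↔
      t ∈ Set.Icc (0 : ℝ) 1 ∧ p ∈ (1 - t) • convexHull ℝ P + t • convexHull ℝ Q := by
  rw [cayleySet, convexHull_union ((Set.singleton_nonempty _).prod hP)
    ((Set.singleton_nonempty _).prod hQ), convexHull_prod, convexHull_prod,
    convexHull_singleton, convexHull_singleton, mem_convexJoin]
  constructor
  · rintro ⟨⟨_, a⟩, ⟨rfl, ha⟩, ⟨_, b⟩, ⟨rfl, hb⟩, u, w, hu, hw, huw, h⟩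
    obtain ⟨h1, h2⟩ := Prod.ext_iff.1 h
    simp only [Prod.smul_mk, Prod.mk_add_mk, smul_eq_mul, mul_zero, mul_one, zero_add] at h1 h2
    subst h1
    obtain rfl : u = 1 - w := by linarith
    exact ⟨⟨hw, by linarith⟩, h2 ▸ Set.add_mem_add (Set.smul_mem_smul_set ha)
      (Set.smul_mem_smul_set hb)⟩
  · rintro ⟨⟨h0, h1⟩, _, ⟨a, ha, rfl⟩, _, ⟨b, hb, rfl⟩, rfl⟩
    refine ⟨(0, a), ⟨rfl, ha⟩, (1, b), ⟨rfl, hb⟩, 1 - t, t, by linarith, h0, by ring, ?_⟩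
    simp

lemma finite_cayleySet (A B : Finset (ℝ × ℝ)) :
    (cayleySet (A : Set (ℝ × ℝ)) B).Finite :=
  ((Set.finite_singleton _).prod A.finite_toSet).union
    ((Set.finite_singleton _).prod B.finite_toSet)

lemma integral_quadratic_form (a b c : ℝ) :
    ∫ t in (0 : ℝ)..1, ((1 - t) ^ 2 * a + (1 - t) * t * b + t ^ 2 * c) =
      a / 3 + b / 6 + c / 3 := by
  have h : ∀ t ∈ Set.uIcc (0 : ℝ) 1, HasDerivAt
      (fun t : ℝ => -(1 - t) ^ 3 / 3 * a + (t ^ 2 / 2 - t ^ 3 / 3) * b + t ^ 3 / 3 * c)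
      ((1 - t) ^ 2 * a + (1 - t) * t * b + t ^ 2 * c) t := by
    intro t _
    have h0 := hasDerivAt_id t
    have h1 := ((((h0.const_sub 1).pow 3).neg.div_const 3).mul_const a).add
      (((h0.pow 2).div_const 2 |>.sub ((h0.pow 3).div_const 3)).mul_const b) |>.add
      (((h0.pow 3).div_const 3).mul_const c)
    refine h1.congr_deriv ?_
    simp only [id, Nat.cast_ofNat, Nat.reduceSub]
    ring
  rw [intervalIntegral.integral_eq_sub_of_hasDerivAt h
    (Continuous.intervalIntegrable (by fun_prop) _ _)]
  ring

lemma volume_convexHull_cayleySet {A B : Finset (ℝ × ℝ)} (hA : A.Nonempty) (hB : B.Nonempty)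
    (hBs : Spans B) :
    6 * volume.real (convexHull ℝ (cayleySet (A : Set (ℝ × ℝ)) B)) =
      volume.real (convexHull ℝ (A : Set (ℝ × ℝ))) +
      volume.real (convexHull ℝ (B : Set (ℝ × ℝ))) +
      volume.real (convexHull ℝ (A : Set (ℝ × ℝ)) + convexHull ℝ (B : Set (ℝ × ℝ))) := by
  set K := convexHull ℝ (cayleySet (A : Set (ℝ × ℝ)) B)
  have hKm : MeasurableSet K := ((finite_cayleySet A B).isCompact_convexHull ℝ).measurableSet
  set a := volume.real (convexHull ℝ (A : Set (ℝ × ℝ)))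
  set c := volume.real (convexHull ℝ (B : Set (ℝ × ℝ)))
  set b := volume.real (convexHull ℝ (A : Set (ℝ × ℝ)) + convexHull ℝ (B : Set (ℝ × ℝ))) -
    a - c with hb
  set g : ℝ → ℝ := fun t => (1 - t) ^ 2 * a + (1 - t) * t * b + t ^ 2 * c with hg
  have hslice : ∀ t, volume (Prod.mk t ⁻¹' K) =
      (Set.Icc (0 : ℝ) 1).indicator (fun t => volume ((1 - t) • convexHull ℝ
        (A : Set (ℝ × ℝ)) + t • convexHull ℝ (B : Set (ℝ × ℝ)))) t := by
    intro t
    by_cases ht : t ∈ Set.Icc (0 : ℝ) 1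
    · rw [Set.indicator_of_mem ht]
      congr 1
      ext p
      simp [K, mk_mem_convexHull_cayleySet (Finset.coe_nonempty.2 hA)
        (Finset.coe_nonempty.2 hB), ht.1, ht.2]
    · rw [Set.indicator_of_notMem ht]
      convert measure_empty (μ := (volume : Measure (ℝ × ℝ)))
      ext p
      simp only [Set.mem_preimage, K, mk_mem_convexHull_cayleySet (Finset.coe_nonempty.2 hA)
        (Finset.coe_nonempty.2 hB), ht, false_and, Set.mem_empty_iff_false]
  have hquad : ∀ t ∈ Set.Ioc (0 : ℝ) 1, volume ((1 - t) • convexHull ℝ (A : Set (ℝ × ℝ)) +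
      t • convexHull ℝ (B : Set (ℝ × ℝ))) = ENNReal.ofReal (g t) ∧ 0 ≤ g t := by
    intro t ht
    have h := volume_smul_convexHull_add_smul_convexHull hA hB hBs (s := 1 - t)
      (by linarith [ht.2]) ht.1
    have hfin := (isCompact_smul_convexHull_add A B (1 - t) t).measure_lt_top
      (μ := volume) |>.ne
    have hgt : g t = volume.real ((1 - t) • convexHull ℝ (A : Set (ℝ × ℝ)) +
      t • convexHull ℝ (B : Set (ℝ × ℝ))) := h.symm
    exact ⟨by rw [hgt, ofReal_measureReal hfin], by rw [hgt]; exact measureReal_nonneg⟩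
  have hgc : Continuous g := by fun_prop
  have hvol : volume K = ENNReal.ofReal (∫ t in Set.Ioc (0 : ℝ) 1, g t) := by
    rw [Measure.volume_eq_prod, Measure.prod_apply hKm]
    simp only [hslice]
    rw [lintegral_indicator measurableSet_Icc,
      ← setLIntegral_congr (μ := volume) (Ioc_ae_eq_Icc (a := (0 : ℝ)) (b := 1)),
      setLIntegral_congr_fun measurableSet_Ioc fun t ht => (hquad t ht).1,
      ofReal_integral_eq_lintegral_ofReal hgc.integrableOn_Ioc]
    exact (ae_restrict_iff' measurableSet_Ioc).2 (.of_forall fun t ht => (hquad t ht).2)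
  have hint : ∫ t in Set.Ioc (0 : ℝ) 1, g t = a / 3 + b / 6 + c / 3 := by
    rw [← intervalIntegral.integral_of_le zero_le_one]
    exact integral_quadratic_form a b c
  have hnn : 0 ≤ ∫ t in Set.Ioc (0 : ℝ) 1, g t :=
    setIntegral_nonneg measurableSet_Ioc fun t ht => (hquad t ht).2
  rw [measureReal_def, hvol, ENNReal.toReal_ofReal hnn, hint, hb]
  ring

/-- The coordinates of `R × R × R`. -/
def tripleEquiv (R : Type*) [CommRing R] : (Fin 3 → R) ≃ₗ[R] R × R × R where
  toFun f := (f 0, f 1, f 2)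
  invFun p := ![p.1, p.2.1, p.2.2]
  map_add' _ _ := rfl
  map_smul' _ _ := rfl
  left_inv f := by ext i; fin_cases i <;> rfl
  right_inv _ := rfl

/-- A surjective endomorphism of `ℤ³` extends to a volume-preserving endomorphism of `ℝ³`. -/
lemma exists_real_extension {F : Pt3 →ₗ[ℤ] Pt3} (hF : Function.Surjective F) :
    ∃ G : ℝ × ℝ × ℝ →ₗ[ℝ] ℝ × ℝ × ℝ, |LinearMap.det G| = 1 ∧
      ∀ p, toR3 (F p) = G (toR3 p) := by
  set f : (Fin 3 → ℤ) →ₗ[ℤ] (Fin 3 → ℤ) :=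
    (tripleEquiv ℤ).symm.toLinearMap ∘ₗ F ∘ₗ (tripleEquiv ℤ).toLinearMap with hf
  set M := LinearMap.toMatrix' f with hM
  have hfs : Function.Surjective f :=
    (tripleEquiv ℤ).symm.surjective.comp (hF.comp (tripleEquiv ℤ).surjective)
  have hunit : IsUnit M.det := by
    have hbij : Function.Bijective f :=
      ⟨OrzechProperty.injective_of_surjective_endomorphism f hfs, hfs⟩
    have := (LinearEquiv.ofBijective f hbij).isUnit_det'
    rw [hM, LinearMap.det_toMatrix']
    exact this
  refine ⟨(tripleEquiv ℝ).toLinearMap ∘ₗ Matrix.toLin' (M.map (Int.castRingHom ℝ)) ∘ₗ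
    (tripleEquiv ℝ).symm.toLinearMap, ?_, fun p => ?_⟩
  · rw [LinearMap.det_conj, LinearMap.det_toLin', ← RingHom.mapMatrix_apply, ← RingHom.map_det]
    rcases Int.isUnit_iff.1 hunit with h | h <;> simp [h]
  · have h1 : ∀ q : Pt3, toR3 q = tripleEquiv ℝ (Int.castRingHom ℝ ∘ (tripleEquiv ℤ).symm q) :=
      fun _ => rfl
    have h2 : (tripleEquiv ℤ).symm (F p) = M.mulVec ((tripleEquiv ℤ).symm p) := by
      rw [← Matrix.toLin'_apply, hM, Matrix.toLin'_toMatrix', hf]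
      simp
    rw [h1 (F p), h2]
    simp only [LinearMap.comp_apply, LinearEquiv.coe_coe, Matrix.toLin'_apply]
    congr 1
    ext i
    rw [h1 p, LinearEquiv.symm_apply_apply]
    exact RingHom.map_mulVec _ _ _ i

/-- The linear part of `L` on the hyperplane containing the Cayley configuration. -/
def cayleyLinear (L : Pt4 →ₗ[ℤ] Pt3) : Pt3 →ₗ[ℤ] Pt3 where
  toFun p := L ((-p.1, p.1), p.2)
  map_add' p q := by
    rw [← map_add]
    congr 1
    ext <;> simp [add_comm]
  map_smul' c p := by
    rw [RingHom.id_apply, ← map_smul]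
    congr 1
    ext <;> simp

lemma cayleyLinear_surjective {L : Pt4 →ₗ[ℤ] Pt3} (hL : Function.Surjective L) {v : Pt}
    (hv : L ((1, 0), v) = 0) : Function.Surjective (cayleyLinear L) := by
  intro z
  obtain ⟨⟨⟨x, y⟩, p⟩, rfl⟩ := hL z
  refine ⟨(y, p - (x + y) • v), ?_⟩
  have h : (((-y, y), p - (x + y) • v) : Pt4) = ((x, y), p) - (x + y) • ((1, 0), v) := by
    ext <;> simp
  change L ((-y, y), p - (x + y) • v) = _
  rw [h, map_sub, map_smul, hv, smul_zero, sub_zero]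

lemma apply_eq_cayleyLinear_add (L : Pt4 →ₗ[ℤ] Pt3) {x y : ℤ} (hxy : x + y = 1) (p : Pt) :
    L ((x, y), p) = cayleyLinear L (y, p) + L ((1, 0), 0) := by
  change _ = L ((-y, y), p) + _
  rw [← map_add]
  congr 1
  ext <;> simp
  linarith

lemma toR3_add (p q : Pt3) : toR3 (p + q) = toR3 p + toR3 q := by
  simp [toR3]

lemma toR2_add (p q : Pt) : toR2 (p + q) = toR2 p + toR2 q := by
  simp [toR2]

/-- A planar lattice configuration as a finite set of real points. -/
def realPoints (A : Finset Pt) : Finset (ℝ × ℝ) := A.image toR2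

lemma coe_realPoints (A : Finset Pt) : (realPoints A : Set (ℝ × ℝ)) = toR2 '' A := by
  simp [realPoints]

lemma spans_realPoints {A : Finset Pt} (hA : FullDim A) : Spans (realPoints A) := by
  by_contra hs
  obtain ⟨h, hh, hc⟩ := not_spans_iff.1 hs
  refine hA ?_
  rw [← coe_realPoints]
  rcases (realPoints A).eq_empty_or_nonempty with he | ⟨a, ha⟩
  · simp [he, collinear_empty]
  rw [collinear_iff_of_mem (p₀ := a) ha]
  refine ⟨(-h.2, h.1), fun p hp => ⟨dot (p - a) (-h.2, h.1) / dot h h, ?_⟩⟩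
  have hd : dot h h ≠ 0 := fun h0 => hh (eq_zero_of_dot_self_eq_zero h0)
  have h0 : dot p h = dot a h := hc p hp a ha
  simp only [dot] at hd h0
  ext
  · simp only [dot, vadd_eq_add, Prod.fst_add, Prod.smul_fst, Prod.fst_sub, Prod.snd_sub,
      smul_eq_mul]
    rw [div_mul_eq_mul_div, ← sub_eq_iff_eq_add, eq_div_iff hd]
    linear_combination h.1 * h0
  · simp only [dot, vadd_eq_add, Prod.snd_add, Prod.smul_snd, Prod.fst_sub, Prod.snd_sub,
      smul_eq_mul]
    rw [div_mul_eq_mul_div, ← sub_eq_iff_eq_add, eq_div_iff hd]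
    linear_combination h.2 * h0

lemma narea_eq (A : Finset Pt) :
    narea A = 2 * volume.real (convexHull ℝ (realPoints A : Set (ℝ × ℝ))) := by
  rw [coe_realPoints]; rfl

lemma narea_add (A B : Finset Pt) :
    narea (A + B) = 2 * volume.real (convexHull ℝ (realPoints A : Set (ℝ × ℝ)) +
      convexHull ℝ (realPoints B : Set (ℝ × ℝ))) := by
  have h : (realPoints (A + B) : Set (ℝ × ℝ)) = realPoints A + realPoints B := by
    simp only [coe_realPoints, Finset.coe_add]
    exact Set.image_add (AddMonoidHom.mk' toR2 toR2_add)
  rw [narea_eq, h, convexHull_add]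

lemma toR3_image_cayley4 (A B : Finset Pt) {L : Pt4 →ₗ[ℤ] Pt3}
    {G : ℝ × ℝ × ℝ →ₗ[ℝ] ℝ × ℝ × ℝ} (hG : ∀ p, toR3 (cayleyLinear L p) = G (toR3 p)) :
    toR3 '' ((cayley4 A B).image (fun p => L p) : Finset Pt3) =
      toR3 (L ((1, 0), 0)) +ᵥ G '' cayleySet (realPoints A : Set (ℝ × ℝ)) (realPoints B) := by
  have h0 : ∀ a : Pt, toR3 (L ((1, 0), a)) =
      toR3 (L ((1, 0), 0)) +ᵥ G ((0 : ℝ), toR2 a) := fun a => by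
    rw [apply_eq_cayleyLinear_add L (by norm_num) a, toR3_add, hG, vadd_eq_add, add_comm]
    simp [toR3, toR2]
  have h1 : ∀ a : Pt, toR3 (L ((0, 1), a)) =
      toR3 (L ((1, 0), 0)) +ᵥ G ((1 : ℝ), toR2 a) := fun a => by
    rw [apply_eq_cayleyLinear_add L (by norm_num) a, toR3_add, hG, vadd_eq_add, add_comm]
    simp [toR3, toR2]
  have hset : ∀ (r : ℝ) (S : Finset Pt),
      ({r} : Set ℝ) ×ˢ (toR2 '' (S : Set Pt)) = (fun a => (r, toR2 a)) '' (S : Set Pt) := by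
    intro r S
    rw [Set.singleton_prod, Set.image_image]
  generalize toR3 (L ((1, 0), 0)) = c at h0 h1 ⊢
  simp only [cayley4, cayleySet, coe_realPoints, Finset.coe_image, Finset.coe_union,
    Set.image_union, Set.image_image, hset, ← Set.image_vadd, h0, h1]

lemma FullDim.nonempty_erase {A : Finset Pt} (hA : FullDim A) (v : Pt) :
    (A.erase v).Nonempty := by
  rw [Finset.nonempty_iff_ne_empty]
  intro he
  have hsub : (A : Set Pt) ⊆ {v} := by
    intro a ha
    by_contra hne
    exact Finset.notMem_empty a (he ▸ Finset.mem_erase.2 ⟨hne, ha⟩)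
  refine hA ((collinear_singleton ℝ (toR2 v)).subset ?_)
  rw [← Set.image_singleton]
  exact Set.image_mono hsub

lemma FullDim.nonempty {A : Finset Pt} (hA : FullDim A) : A.Nonempty :=
  (hA.nonempty_erase 0).mono (Finset.erase_subset _ _)

lemma nvol3_image_cayley4 {A B : Finset Pt} (hA : A.Nonempty) (hB : FullDim B)
    {L : Pt4 →ₗ[ℤ] Pt3} (hL : Function.Surjective L) {v : Pt} (hv : L ((1, 0), v) = 0) :
    nvol3 ((cayley4 A B).image fun p => L p) = narea A + narea B + mvol A B := by
  obtain ⟨G, hdet, hG⟩ := exists_real_extension (cayleyLinear_surjective hL hv)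
  have hv := volume_convexHull_cayleySet (A := realPoints A) (B := realPoints B)
    (hA.image _) (hB.nonempty.image _) (spans_realPoints hB)
  have : (volume : Measure (ℝ × ℝ × ℝ)).IsAddHaarMeasure :=
    Measure.prod.instIsAddHaarMeasure (volume : Measure ℝ) (volume : Measure (ℝ × ℝ))
  rw [nvol3, toR3_image_cayley4 A B hG, convexHull_vadd, measure_vadd,
    ← LinearMap.image_convexHull, Measure.addHaar_image_linearMap, hdet, ENNReal.ofReal_one,
    one_mul, ← measureReal_def, hv, mvol, narea_add, narea_eq, narea_eq]
  ring

lemma erase_cayley4 (A B : Finset Pt) (v : Pt) :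
    (cayley4 A B).erase ((1, 0), v) = cayley4 (A.erase v) B := by
  ext ⟨⟨x, y⟩, p⟩
  simp only [cayley4, Finset.mem_erase, Finset.mem_union, Finset.mem_image, Prod.mk.injEq, ne_eq]
  grind

lemma nvol3_cayley4_sub_erase {A B : Finset Pt} (hA : FullDim A) (hB : FullDim B)
    {L : Pt4 →ₗ[ℤ] Pt3} (hL : Function.Surjective L) {v : Pt} (hv : L ((1, 0), v) = 0) :
    nvol3 ((cayley4 A B).image fun p => L p) -
        nvol3 (((cayley4 A B).erase ((1, 0), v)).image fun p => L p) =
      (narea A - narea (A.erase v)) + mmult A B v := by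
  rw [erase_cayley4, nvol3_image_cayley4 hA.nonempty hB hL hv,
    nvol3_image_cayley4 (hA.nonempty_erase v) hB hL hv, mmult]
  ring

/-- The exchange of the two summands of the Cayley configuration. -/
def swapSummands : Pt4 ≃ₗ[ℤ] Pt4 :=
  (LinearEquiv.prodComm ℤ ℤ ℤ).prodCongr (LinearEquiv.refl ℤ Pt)

lemma cayley4_image_swapSummands (A B : Finset Pt) :
    (cayley4 A B).image swapSummands = cayley4 B A := by
  simp only [cayley4, Finset.image_union, Finset.image_image]
  exact Finset.union_comm _ _

/-- **Lemma 3.7.**  Let `v` be a vertex of `A_i` (for `i = 1,2`), regarded also as a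
vertex of the Cayley configuration `A = Cay(A₁,A₂)`.  The subdiagram volume `u(v,A)` —
computed as the normalized volume defect of the projection of `A` by any surjective
integer linear map `L : ℤ⁴ → ℤ³` killing the lifted vertex — equals
`u(v,A_i) + mmult(v)`, where `u(v,A_i) = area(Q_i) − area(conv(A_i∖v))`. -/
theorem subdiagram_volume_vertex_in_cayley
    (A₁ A₂ : Finset Pt) (h₁ : FullDim A₁) (h₂ : FullDim A₂) :
    (∀ v : Pt, IsVertex A₁ v →
      ∀ L : Pt4 →ₗ[ℤ] Pt3, Function.Surjective L →
        L ((((1:ℤ),(0:ℤ)) : Pt), v) = 0 →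
        nvol3 ((cayley4 A₁ A₂).image (fun p => L p))
            - nvol3 (((cayley4 A₁ A₂).erase ((((1:ℤ),(0:ℤ)) : Pt), v)).image
                (fun p => L p))
          = (narea A₁ - narea (A₁.erase v)) + mmult A₁ A₂ v)
    ∧ (∀ v : Pt, IsVertex A₂ v →
      ∀ L : Pt4 →ₗ[ℤ] Pt3, Function.Surjective L →
        L ((((0:ℤ),(1:ℤ)) : Pt), v) = 0 →
        nvol3 ((cayley4 A₁ A₂).image (fun p => L p))
            - nvol3 (((cayley4 A₁ A₂).erase ((((0:ℤ),(1:ℤ)) : Pt), v)).image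
                (fun p => L p))
          = (narea A₂ - narea (A₂.erase v)) + mmult A₂ A₁ v) := by
  refine ⟨fun v _ L hL hv => nvol3_cayley4_sub_erase h₁ h₂ hL hv, fun v _ L hL hv => ?_⟩
  have h := nvol3_cayley4_sub_erase h₂ h₁ (L := L ∘ₗ swapSummands.toLinearMap) (v := v)
    (hL.comp swapSummands.surjective) hv
  have himage : ∀ S : Finset Pt4, S.image (fun p => (L ∘ₗ swapSummands.toLinearMap) p) =
      (S.image swapSummands).image fun p => L p := fun S => by
    rw [Finset.image_image]; rfl
  rw [himage, himage, Finset.image_erase swapSummands.injective,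
    cayley4_image_swapSummands] at h
  exact h

end
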